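/- arXiv:1707.00549 — 2 statements merged into one kernel-verified Lean document; each statement's English description precedes it below -/
import Mathlib

section
/- Let p ∈ {3,5}, q = p^k with k even, and U = {x in F_{q^2} : x^{q+1} = 1}. Then the map x ↦ (x + 1 - x^{p-1}) / (x^p + x^{p-1} - x) is a bijection of U onto U. Moreover, if k is odd, this map does not permute U. -/
theorem pow_fix8 {F : Type*} [Field F] (p k : ℕ) (hp : p = 3 ∨ p = 5) (hk : Even k) (z : F)
    (hz : z ^ 8 = 1) : z ^ (p ^ k) = z := by
  obtain ⟨m, rfl⟩ := hk
  have h : p ^ (m + m) % 8 = 1 := by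
    rw [← two_mul, pow_mul, Nat.pow_mod]
    rcases hp with rfl | rfl <;> simp
  rw [← Nat.div_add_mod (p ^ (m + m)) 8, h, pow_succ, pow_mul, hz]
  simp

theorem key {F : Type*} [Field F] (p k : ℕ) (hp : p = 3 ∨ p = 5) (hk : Even k)
    (hp0 : (p : F) = 0) (φ : F →+* F) (hφ : ∀ x, φ x = x ^ (p ^ k))
    (X Y : F) (hX : φ X = 1 - X) (hY : φ Y = 1 - Y)
    (h3 : p = 3 → X ^ 3 + X + 1 = Y ^ 3 + Y + 1)
    (h5 : p = 5 → 1 + X + X ^ 2 + X ^ 3 + X ^ 5 = 1 + Y + Y ^ 2 + Y ^ 3 + Y ^ 5) : X = Y := by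
  have h2 : (2 : F) ≠ 0 := by
    intro h
    rcases hp with rfl | rfl
    · push_cast at hp0
      exact one_ne_zero (α := F) (by linear_combination hp0 - h)
    · push_cast at hp0
      exact one_ne_zero (α := F) (by linear_combination hp0 - 2 * h)
  have anti : ∀ z : F, z ^ 8 = 1 → φ z = - z → False := by
    intro z hz hn
    have h := pow_fix8 p k hp hk z hz
    rw [← hφ, hn] at h
    have : z = 0 := by
      have : 2 * z = 0 := by linear_combination -h
      simpa [h2] using this
    simp [this] at hz
  have hs : φ (X - Y) = -(X - Y) := by rw [map_sub, hX, hY]; ring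
  by_contra hne
  have hs0 : X - Y ≠ 0 := sub_ne_zero.mpr hne
  rcases hp with rfl | rfl
  · push_cast at hp0
    have h := h3 rfl
    have h1 : (X - Y) * ((X - Y) ^ 2 + 1) = 0 := by
      linear_combination h + (-X ^ 2 * Y + X * Y ^ 2) * hp0
    have h4 : (X - Y) ^ 2 = -1 := by
      have := (mul_eq_zero.mp h1).resolve_left hs0
      linear_combination this
    refine anti _ ?_ hs
    rw [show 8 = 2 * 4 from rfl, pow_mul, h4]; norm_num
  · push_cast at hp0
    have h := h5 rfl
    have h1 : (X - Y) * ((X + Y - 1) ^ 2 - 2 * ((X - Y) ^ 2 + 2) ^ 2) = 0 := by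
      linear_combination 3 * h + (-2 * (X - Y) - (X ^ 2 - Y ^ 2) - 2 * X ^ 3 + 5 * X ^ 2 * Y - 5 * X * Y ^ 2 + 2 * Y ^ 3
        - X ^ 5 + 2 * X ^ 4 * Y - 4 * X ^ 3 * Y ^ 2 + 4 * X ^ 2 * Y ^ 3 - 2 * X * Y ^ 4 + Y ^ 5) * hp0
    have h4 := (mul_eq_zero.mp h1).resolve_left hs0
    have hm : φ (X + Y - 1) = -(X + Y - 1) := by rw [map_sub, map_add, hX, hY, map_one]; ring
    have hn : φ ((X - Y) ^ 2 + 2) = (X - Y) ^ 2 + 2 := by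
      rw [map_add, map_pow, hs, map_ofNat]; ring
    by_cases hn0 : (X - Y) ^ 2 + 2 = 0
    · refine anti _ ?_ hs
      rw [show 8 = 2 * 4 from rfl, pow_mul, eq_neg_of_add_eq_zero_left hn0]
      linear_combination 3 * hp0
    · refine anti ((X + Y - 1) / ((X - Y) ^ 2 + 2)) ?_ ?_
      · have : ((X + Y - 1) / ((X - Y) ^ 2 + 2)) ^ 2 = 2 := by
          rw [div_pow, div_eq_iff (pow_ne_zero _ hn0)]
          linear_combination h4
        rw [show 8 = 2 * 4 from rfl, pow_mul, this]
        linear_combination 3 * hp0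
      · rw [map_div₀, hm, hn, neg_div]

theorem stmt_16 (p k : ℕ) (hp : p = 3 ∨ p = 5) (hk : 0 < k) (F : Type*) [Field F]
    [Fintype F] (hF : Fintype.card F = (p ^ k) ^ 2) :
    (Even k →
      Set.BijOn (fun x : F => (x + 1 - x ^ (p - 1)) / (x ^ p + x ^ (p - 1) - x))
        {x : F | x ^ (p ^ k + 1) = 1} {x : F | x ^ (p ^ k + 1) = 1}) ∧
    (Odd k →
      ¬ Set.BijOn (fun x : F => (x + 1 - x ^ (p - 1)) / (x ^ p + x ^ (p - 1) - x))
        {x : F | x ^ (p ^ k + 1) = 1} {x : F | x ^ (p ^ k + 1) = 1}) := by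
  have hpp : p.Prime := by rcases hp with rfl | rfl <;> norm_num
  have : Fact p.Prime := ⟨hpp⟩
  have hp0 : (p : F) = 0 := by
    have h := Nat.cast_card_eq_zero F
    rw [hF] at h
    push_cast at h
    exact pow_eq_zero_iff hk.ne' |>.mp (pow_eq_zero_iff two_ne_zero |>.mp h)
  have : CharP F p := (CharP.charP_iff_prime_eq_zero hpp).mpr hp0
  set φ : F →+* F := iterateFrobenius F p k with hφd
  have hφ : ∀ x, φ x = x ^ (p ^ k) := fun x => by rw [hφd, iterateFrobenius_def]
  have hU : ∀ x : F, x ^ (p ^ k + 1) = 1 ↔ φ x * x = 1 := fun x => by rw [pow_succ, hφ]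
  constructor
  · intro he
    -- sum of numerator and denominator
    have hsum : ∀ x : F, (x + 1 - x ^ (p - 1)) + (x ^ p + x ^ (p - 1) - x) = (x + 1) ^ p := by
      intro x
      rw [add_pow_char, one_pow]; ring
    have hconjN : ∀ x : F, φ x * x = 1 →
        φ (x + 1 - x ^ (p - 1)) * x ^ p = x ^ p + x ^ (p - 1) - x := by
      intro x hx
      obtain ⟨n, hn⟩ : ∃ n, p = n + 1 := ⟨p - 1, by have := hpp.pos; omega⟩
      have hxn : φ x ^ n * x ^ n = 1 := by rw [← mul_pow, hx, one_pow]
      simp only [map_sub, map_add, map_one, map_pow, hn, Nat.add_sub_cancel]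
      linear_combination x ^ n * hx - x * hxn
    have hconjD : ∀ x : F, φ x * x = 1 →
        φ (x ^ p + x ^ (p - 1) - x) * x ^ p = x + 1 - x ^ (p - 1) := by
      intro x hx
      obtain ⟨n, hn⟩ : ∃ n, p = n + 1 := ⟨p - 1, by have := hpp.pos; omega⟩
      have hxn : φ x ^ n * x ^ n = 1 := by rw [← mul_pow, hx, one_pow]
      simp only [map_sub, map_add, map_pow, hn, Nat.add_sub_cancel]
      linear_combination (φ x ^ n * x ^ n - x ^ n) * hx + (1 + x) * hxn
    have hD : ∀ x : F, φ x * x = 1 → x ^ p + x ^ (p - 1) - x ≠ 0 := by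
      intro x hx h0
      have hN := hconjD x hx
      rw [h0, map_zero, zero_mul] at hN
      have h1 := hsum x
      rw [h0, ← hN, add_zero] at h1
      have h2 : x + 1 = 0 := pow_eq_zero_iff hpp.ne_zero |>.mp h1.symm
      have h3 : x = -1 := by linear_combination h2
      rw [h3] at h0
      apply one_ne_zero (α := F)
      rcases hp with rfl | rfl <;> norm_num at h0
    have hN : ∀ x : F, φ x * x = 1 → x + 1 - x ^ (p - 1) ≠ 0 := by
      intro x hx h0
      apply hD x hx
      rw [← hconjN x hx, h0, map_zero, zero_mul]
    have hmaps : Set.MapsTo (fun x : F => (x + 1 - x ^ (p - 1)) / (x ^ p + x ^ (p - 1) - x))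
        {x : F | x ^ (p ^ k + 1) = 1} {x : F | x ^ (p ^ k + 1) = 1} := by
      intro x hx
      simp only [Set.mem_ofPred_eq, hU] at hx ⊢
      have hx0 : x ≠ 0 := by rintro rfl; simp at hx
      have a := hconjN x hx
      have b := hconjD x hx
      have c := hD x hx
      have d := hN x hx
      generalize x + 1 - x ^ (p - 1) = N at *
      generalize x ^ p + x ^ (p - 1) - x = D at *
      have hD' : φ D ≠ 0 := by intro h; rw [h, zero_mul] at b; exact d b.symm
      rw [map_div₀, div_mul_div_comm, div_eq_one_iff_eq (mul_ne_zero hD' c)]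
      apply mul_right_cancel₀ (pow_ne_zero p hx0)
      linear_combination N * a - D * b
    have hinj : Set.InjOn (fun x : F => (x + 1 - x ^ (p - 1)) / (x ^ p + x ^ (p - 1) - x))
        {x : F | x ^ (p ^ k + 1) = 1} := by
      intro x hx y hy hxy
      simp only [Set.mem_ofPred_eq, hU] at hx hy
      have hxy' := hxy
      simp only at hxy'
      rw [div_eq_div_iff (hD x hx) (hD y hy)] at hxy'
      have e : (x + 1) ^ p * (y ^ p + y ^ (p - 1) - y) = (y + 1) ^ p * (x ^ p + x ^ (p - 1) - x) := by
        rw [← hsum, ← hsum]; linear_combination hxy'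
      by_cases hx1 : x + 1 = 0
      · rw [hx1, zero_pow hpp.ne_zero, zero_mul] at e
        have h2 := (mul_eq_zero.mp e.symm).resolve_right (hD x hx)
        have h3 : y + 1 = 0 := pow_eq_zero_iff hpp.ne_zero |>.mp h2
        linear_combination hx1 - h3
      by_cases hy1 : y + 1 = 0
      · rw [hy1, zero_pow hpp.ne_zero, zero_mul] at e
        have h2 := (mul_eq_zero.mp e).resolve_right (hD y hy)
        exact absurd (pow_eq_zero_iff hpp.ne_zero |>.mp h2) hx1
      have hconj : ∀ z : F, φ z * z = 1 → z + 1 ≠ 0 → φ ((z + 1)⁻¹) = 1 - (z + 1)⁻¹ := by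
        intro z hz hz1
        have hz2 : φ (z + 1) ≠ 0 := (map_ne_zero φ).mpr hz1
        rw [map_inv₀]
        rw [map_add, map_one] at hz2 ⊢
        field_simp
        linear_combination -hz
      have hX : x * (x + 1)⁻¹ = 1 - (x + 1)⁻¹ := by field_simp; ring
      have hY : y * (y + 1)⁻¹ = 1 - (y + 1)⁻¹ := by field_simp; ring
      have e2 : (y ^ p + y ^ (p - 1) - y) * (y + 1)⁻¹ ^ p
          = (x ^ p + x ^ (p - 1) - x) * (x + 1)⁻¹ ^ p := by
        rw [inv_pow, inv_pow, ← div_eq_mul_inv, ← div_eq_mul_inv,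
          div_eq_div_iff (pow_ne_zero _ hy1) (pow_ne_zero _ hx1)]
        linear_combination e
      have hXY : (x + 1)⁻¹ = (y + 1)⁻¹ := by
        refine key p k hp he hp0 φ hφ _ _ (hconj x hx hx1) (hconj y hy hy1) ?_ ?_
        · rintro rfl
          push_cast at hp0
          have g : ∀ z Z : F, z * Z = 1 - Z →
              (z ^ 3 + z ^ (3 - 1) - z) * Z ^ 3 = Z ^ 3 + Z + 1 := by
            intro z Z h
            have : (z ^ 3 + z ^ (3 - 1) - z) * Z ^ 3
                = (z * Z) ^ 3 + (z * Z) ^ 2 * Z - (z * Z) * Z ^ 2 := by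
              norm_num; ring
            rw [this, h]
            linear_combination (-Z) * hp0
          rw [← g x _ hX, ← g y _ hY, e2]
        · rintro rfl
          push_cast at hp0
          have g : ∀ z Z : F, z * Z = 1 - Z →
              (z ^ 5 + z ^ (5 - 1) - z) * Z ^ 5 = 1 + Z + Z ^ 2 + Z ^ 3 + Z ^ 5 := by
            intro z Z h
            have : (z ^ 5 + z ^ (5 - 1) - z) * Z ^ 5
                = (z * Z) ^ 5 + (z * Z) ^ 4 * Z - (z * Z) * Z ^ 4 := by
              norm_num; ring
            rw [this, h]
            linear_combination (-Z + Z ^ 2 - Z ^ 3) * hp0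
          rw [← g x _ hX, ← g y _ hY, e2]
      have := inv_injective hXY
      linear_combination this
    refine ⟨hmaps, hinj, ?_⟩
    have himg := Set.eq_of_subset_of_ncard_le hmaps.image_subset
      (le_of_eq (Set.ncard_image_of_injOn hinj).symm) (Set.toFinite _)
    exact himg.symm.subset
  · rintro ⟨m, rfl⟩ hB
    have hinj := hB.injOn
    have h1 : (1 : F) ∈ {x : F | x ^ (p ^ (2 * m + 1) + 1) = 1} := by simp
    have hrc : ringChar F = p := ringChar.eq F p
    rcases hp with rfl | rfl
    · push_cast at hp0
      have hc : Fintype.card F % 4 = 1 := by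
        rw [hF, ← pow_mul, mul_comm, pow_mul, Nat.pow_mod]; norm_num
      obtain ⟨i, hi⟩ := FiniteField.isSquare_neg_one_iff.mpr (by rw [hc]; norm_num : Fintype.card F % 4 ≠ 3)
      have hq : (3 ^ (2 * m + 1) + 1) % 4 = 0 := by
        rw [pow_succ, pow_mul, Nat.add_mod, Nat.mul_mod, Nat.pow_mod]; norm_num
      have hi4 : i ^ 4 = 1 := by linear_combination (1 - i * i) * hi
      have hiU : i ∈ {x : F | x ^ (3 ^ (2 * m + 1) + 1) = 1} := by
        rw [Set.mem_ofPred_eq, ← Nat.div_add_mod (3 ^ (2 * m + 1) + 1) 4, hq, add_zero, pow_mul, hi4,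
          one_pow]
      have hne : i = 1 := by
        apply hinj hiU h1
        have hd : i ^ 3 + i ^ 2 - i ≠ 0 := by
          intro h
          have h2 : i = 1 := by linear_combination h + i * hi + hi + i * hp0
          rw [h2] at h
          norm_num at h
        norm_num
        rw [div_eq_one_iff_eq hd]
        linear_combination (i + 2) * hi + i * hp0 + hp0
      rw [hne] at hi
      apply one_ne_zero (α := F)
      linear_combination hp0 + hi
    · push_cast at hp0
      have h20 : (2 : F) ≠ 0 := by
        intro h
        exact one_ne_zero (α := F) (by linear_combination hp0 - 2 * h)
      obtain ⟨w, hw⟩ : IsSquare (2 : F) := by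
        rw [FiniteField.isSquare_iff (by rw [hrc]; norm_num) h20]
        have hc : Fintype.card F % 8 = 1 := by
          rw [hF, ← pow_mul, mul_comm, pow_mul, Nat.pow_mod]; norm_num
        have hc2 : Fintype.card F / 2 = 4 * (Fintype.card F / 8) := by omega
        rw [hc2, pow_mul]
        have : (2 : F) ^ 4 = 1 := by linear_combination 3 * hp0
        rw [this, one_pow]
      obtain ⟨x, hx⟩ : ∃ x : F, x = 2 * w - 2 := ⟨_, rfl⟩
      have hx2 : x ^ 2 - x + 1 = 0 := by
        rw [hx]
        linear_combination (-4) * hw + (3 - 2 * w) * hp0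
      have hx6 : x ^ 6 = 1 := by
        linear_combination (x ^ 4 + x ^ 3 - x - 1) * hx2
      have hq : (5 ^ (2 * m + 1) + 1) % 6 = 0 := by
        rw [pow_succ, pow_mul, Nat.add_mod, Nat.mul_mod, Nat.pow_mod]; norm_num
      have hxU : x ∈ {x : F | x ^ (5 ^ (2 * m + 1) + 1) = 1} := by
        rw [Set.mem_ofPred_eq, ← Nat.div_add_mod (5 ^ (2 * m + 1) + 1) 6, hq, add_zero, pow_mul, hx6,
          one_pow]
      have hx3 : x ^ 3 = -1 := by linear_combination (x + 1) * hx2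
      have hne : x = 1 := by
        apply hinj hxU h1
        have hd : x ^ 5 + x ^ 4 - x ≠ 0 := by
          intro h
          have h3 : 1 - 3 * x = 0 := by
            linear_combination h - (x ^ 2 + x) * hx3 + hx2
          have h4 : x = 2 := by linear_combination (-2) * h3 - x * hp0
          rw [h4] at hx2
          exact h20 (by linear_combination hp0 - hx2)
        norm_num
        rw [div_eq_one_iff_eq hd]
        linear_combination (-(x - 1) * (x ^ 2 - x + 1)) * hx2 + (-x ^ 4 + x ^ 3 - x ^ 2 + x) * hp0
      rw [hne] at hx2
      apply one_ne_zero (α := F)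
      linear_combination hx2
end

section
/- Let p ∈ {3,5}, q = p^k, and l a nonnegative integer with gcd(2l+p, q-1) = 1. Then g(x) = x^{(q+1)l + (p-1)q + 1} + x^{(q+1)l + pq} - x^{(q+1)l + q + (p-1)} is a permutation polynomial of F_{q^2} if and only if k is even. -/
lemma core_inj {F : Type*} [Field F] (σ : F →+* F) (hσ : ∀ x, σ (σ x) = x) (h2 : (2 : F) ≠ 0)
    (p l : ℕ) (hp0 : p ≠ 0) (P : F → F) (δ : F → F → F)
    (hS : ∀ x, P x + σ (P x) = (x + σ x) ^ p)
    (hD : ∀ x, P x - σ (P x) = δ (x + σ x) (x - σ x))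
    (hP : ∀ a x, σ a = a → P (a * x) = a ^ p * P x)
    (hδ : ∀ a s d, δ (a * s) (a * d) = a ^ p * δ s d)
    (hinj : ∀ T d e, σ T = T → σ d = -d → σ e = -e → δ T d = δ T e → d = e)
    (hone : ∀ a, σ a = a → a ^ (2 * l + p) = 1 → a = 1) :
    Function.Injective (fun x => (x * σ x) ^ l * P x) := by
  have hsf : ∀ x, σ (x + σ x) = x + σ x := fun x => by rw [map_add, hσ]; ring
  have hdf : ∀ x, σ (x - σ x) = -(x - σ x) := fun x => by rw [map_sub, hσ]; ring
  have hNf : ∀ x, σ ((x * σ x) ^ l) = (x * σ x) ^ l := fun x => by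
    rw [map_pow, map_mul, hσ, mul_comm]
  have ext' : ∀ x y : F, x + σ x = y + σ y → x - σ x = y - σ y → x = y := by
    intro x y h1 h3
    apply mul_left_cancel₀ h2
    linear_combination h1 + h3
  have hδ0 : δ 0 0 = 0 := by
    have h := hδ 0 0 0
    simpa [hp0] using h
  have hN0 : ∀ x, x ≠ 0 → (x * σ x) ^ l ≠ 0 := fun x hx =>
    pow_ne_zero _ (mul_ne_zero hx ((map_ne_zero σ).2 hx))
  have hP0 : P 0 = 0 := by
    have h := hP 0 0 (map_zero σ)
    simpa [hp0] using h
  have hP0' : ∀ x, P x = 0 → x = 0 := by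
    intro x hx
    have h1 := hS x
    have h3 := hD x
    rw [hx, map_zero, add_zero] at h1
    rw [hx, map_zero, sub_zero] at h3
    have hs : x + σ x = 0 := by
      by_contra h
      exact pow_ne_zero p h h1.symm
    rw [hs] at h3
    have hd := hinj 0 (x - σ x) 0 (map_zero σ) (hdf x) (by simp) (by rw [hδ0, ← h3])
    apply ext' x 0 <;> simp [hs, hd]
  have hG0 : ∀ x, (x * σ x) ^ l * P x = 0 → x = 0 := by
    intro x hx
    by_contra h
    rcases mul_eq_zero.1 hx with h' | h'
    · exact hN0 x h h'
    · exact h (hP0' x h')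
  intro x y hxy
  simp only at hxy
  by_cases hx : x = 0
  · subst hx
    rw [hP0, mul_zero] at hxy
    exact (hG0 y hxy.symm).symm
  by_cases hy : y = 0
  · subst hy
    rw [hP0, mul_zero] at hxy
    exact hG0 x hxy
  have hxy' := congrArg σ hxy
  rw [map_mul, map_mul, hNf, hNf] at hxy'
  have e1 : (x * σ x) ^ l * (x + σ x) ^ p = (y * σ y) ^ l * (y + σ y) ^ p := by
    rw [← hS, ← hS]; linear_combination hxy + hxy'
  have e2 : (x * σ x) ^ l * δ (x + σ x) (x - σ x) = (y * σ y) ^ l * δ (y + σ y) (y - σ y) := by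
    rw [← hD, ← hD]; linear_combination hxy - hxy'
  have e3 : (x + σ x) ^ p * δ (y + σ y) (y - σ y) = (y + σ y) ^ p * δ (x + σ x) (x - σ x) := by
    apply mul_left_cancel₀ (mul_ne_zero (hN0 x hx) (hN0 y hy))
    linear_combination (y * σ y) ^ l * δ (y + σ y) (y - σ y) * e1
      - (y * σ y) ^ l * (y + σ y) ^ p * e2
  rw [← hδ, ← hδ, mul_comm (y + σ y) (x + σ x)] at e3
  have e4 := hinj _ _ _ (by rw [map_mul, hsf, hsf]) (by rw [map_mul, hsf, hdf]; ring)
    (by rw [map_mul, hsf, hdf]; ring) e3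
  obtain ⟨a, ha, hyx⟩ : ∃ a, σ a = a ∧ y = a * x := by
    by_cases hs : x + σ x = 0
    · have hs' : y + σ y = 0 := by
        rw [hs, zero_pow hp0, mul_zero] at e1
        by_contra h
        exact mul_ne_zero (hN0 y hy) (pow_ne_zero p h) e1.symm
      refine ⟨y / x, ?_, by field_simp⟩
      rw [map_div₀, eq_neg_of_add_eq_zero_right hs, eq_neg_of_add_eq_zero_right hs', neg_div_neg_eq]
    · have ha : σ ((y + σ y) / (x + σ x)) = (y + σ y) / (x + σ x) := by
        rw [map_div₀, hsf, hsf]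
      refine ⟨(y + σ y) / (x + σ x), ha, ?_⟩
      apply ext'
      · rw [map_mul, ha]; field_simp
      · rw [map_mul, ha]
        field_simp
        linear_combination e4
  have : a = 1 := by
    apply hone a ha
    rw [hyx, hP a x ha, map_mul, ha] at hxy
    have hne : (x * σ x) ^ l * P x ≠ 0 := fun h => hx (hG0 x h)
    apply mul_right_cancel₀ hne
    rw [one_mul]
    refine Eq.trans ?_ hxy.symm
    ring
  rw [hyx, this, one_mul]

lemma inj3 {F : Type*} [Field F] [CharP F 3] (σ : F →+* F) (i : F) (hi : i ^ 2 = -1)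
    (hσi : σ i = i) (T d e : F) (hT : σ T = T) (hd : σ d = -d) (he : σ e = -e)
    (h : d ^ 3 + d * T ^ 2 = e ^ 3 + e * T ^ 2) : d = e := by
  have h3 : (3 : F) = 0 := by exact_mod_cast CharP.cast_eq_zero F 3
  have h2 : (2 : F) ≠ 0 := fun h => one_ne_zero (α := F) (by linear_combination h3 - h)
  have key : (d - e) * ((d - e - i * T) * (d - e + i * T)) = 0 := by
    linear_combination h - d * e * (d - e) * h3 - (d - e) * T ^ 2 * hi
  have fin : ∀ z : F, σ z = z → d - e = z → d = e := by
    intro z hz h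
    have h' := congrArg σ h
    rw [map_sub, hd, he, hz, ← h] at h'
    apply mul_left_cancel₀ h2
    linear_combination -h'
  rcases mul_eq_zero.1 key with h | h
  · exact sub_eq_zero.1 h
  rcases mul_eq_zero.1 h with h | h
  · exact fin (i * T) (by rw [map_mul, hσi, hT]) (by linear_combination h)
  · exact fin (-(i * T)) (by rw [map_neg, map_mul, hσi, hT]) (by linear_combination h)

lemma inj5 {F : Type*} [Field F] [CharP F 5] (σ : F →+* F) (r : F) (hr : r ^ 2 = 3)
    (hσr : σ r = r) (T d e : F) (hT : σ T = T) (hd : σ d = -d) (he : σ e = -e)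
    (h : d * (d ^ 2 + 2 * T ^ 2) ^ 2 = e * (e ^ 2 + 2 * T ^ 2) ^ 2) : d = e := by
  have h5 : (5 : F) = 0 := by exact_mod_cast CharP.cast_eq_zero F 5
  have h2 : (2 : F) ≠ 0 := fun h => one_ne_zero (α := F) (by linear_combination h5 - 2 * h)
  have hσ2 : σ 2 = 2 := map_ofNat σ 2
  have fin : ∀ z w : F, σ z = z → σ w = - w → w = z → w = 0 := by
    intro z w hz hw h
    have h' := congrArg σ h
    rw [hw, hz, ← h] at h'
    apply mul_left_cancel₀ h2
    linear_combination -h'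
  by_contra hne
  have hne' := sub_ne_zero.2 hne
  have key : (T * (d + e) - r * ((d - e) ^ 2 - 2 * T ^ 2)) *
      (T * (d + e) + r * ((d - e) ^ 2 - 2 * T ^ 2)) = 0 := by
    apply mul_left_cancel₀ hne'
    grind
  have hh : T * (d + e) = 0 := by
    rcases mul_eq_zero.1 key with h | h
    · exact fin (r * ((d - e) ^ 2 - 2 * T ^ 2)) _ (by simp only [map_neg, map_mul, map_sub, map_pow, hσ2, hσr, hT, hd, he]; ring)
        (by simp [hT, hd, he]; ring) (by linear_combination h)
    · exact fin (-(r * ((d - e) ^ 2 - 2 * T ^ 2))) _ (by simp only [map_neg, map_mul, map_sub, map_pow, hσ2, hσr, hT, hd, he]; ring)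
        (by simp [hT, hd, he]; ring) (by linear_combination h)
  have hr0 : r ≠ 0 := by
    rintro rfl
    apply h2
    linear_combination h5 + hr
  have hq : (d - e) ^ 2 - 2 * T ^ 2 = 0 := by
    rw [hh] at key
    have : (r * ((d - e) ^ 2 - 2 * T ^ 2)) ^ 2 = 0 := by linear_combination -key
    exact (mul_eq_zero.1 (pow_eq_zero_iff (two_ne_zero)|>.1 this)).resolve_left hr0
  have k2 : (d - e - 2 * r * T) * (d - e + 2 * r * T) = 0 := by
    linear_combination hq - 4 * T ^ 2 * hr - 2 * T ^ 2 * h5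
  apply hne'
  rcases mul_eq_zero.1 k2 with h | h
  · exact fin (2 * r * T) _ (by simp [hσ2, hσr, hT]) (by simp [hd, he]; ring) (by linear_combination h)
  · exact fin (-(2 * r * T)) _ (by simp [hσ2, hσr, hT]) (by simp [hd, he]; ring)
      (by linear_combination h)

lemma pow_period {F : Type*} [Field F] (r : F) (hr : r ^ 8 = 1) (n m : ℕ) (h : n % 8 = m % 8) :
    r ^ n = r ^ m := by
  rw [← Nat.div_add_mod n 8, ← Nat.div_add_mod m 8, pow_add, pow_add, pow_mul, pow_mul, hr, h]
  simp

lemma sq_mod (q : ℕ) (h : q % 2 = 1) : q ^ 2 % 8 = 1 := by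
  have : q % 8 = 1 ∨ q % 8 = 3 ∨ q % 8 = 5 ∨ q % 8 = 7 := by omega
  rcases this with h | h | h | h <;> simp [Nat.pow_mod, h]

lemma pow_mod_even (p k : ℕ) (hp : p = 3 ∨ p = 5) (h : Even k) : p ^ k % 8 = 1 := by
  obtain ⟨j, rfl⟩ := h
  rw [← two_mul, pow_mul]
  rcases hp with rfl | rfl <;> simp [Nat.pow_mod]

lemma pow_mod_odd (p k : ℕ) (hp : p = 3 ∨ p = 5) (h : ¬ Even k) : p ^ k % 8 = p := by
  obtain ⟨j, rfl⟩ := Nat.not_even_iff_odd.1 h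
  rw [pow_succ, pow_mul]
  rcases hp with rfl | rfl <;> simp [Nat.pow_mod, Nat.mul_mod]

lemma hone_aux {F : Type*} [Field F] (q n : ℕ) (hq : 0 < q) (hn : n ≠ 0)
    (hg : Nat.gcd n (q - 1) = 1) (a : F) (ha : a ^ q = a) (h : a ^ n = 1) : a = 1 := by
  have h0 : a ≠ 0 := by
    rintro rfl
    simp [hn] at h
  have h1 : a ^ (q - 1) = 1 := by
    apply mul_right_cancel₀ h0
    rw [← pow_succ, Nat.sub_add_cancel hq, ha, one_mul]
  have := pow_gcd_eq_one.2 ⟨h, h1⟩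
  rwa [hg, pow_one] at this

theorem stmt_17 (p k l : ℕ) (hp : p = 3 ∨ p = 5) (hk : 0 < k)
    (hl : Nat.gcd (2 * l + p) (p ^ k - 1) = 1) (F : Type*) [Field F] [Fintype F]
    (hF : Fintype.card F = (p ^ k) ^ 2) :
    Function.Bijective
        (fun x : F =>
          x ^ ((p ^ k + 1) * l + (p - 1) * p ^ k + 1)
            + x ^ ((p ^ k + 1) * l + p * p ^ k)
            - x ^ ((p ^ k + 1) * l + p ^ k + (p - 1))) ↔
      Even k := by
  have hpp : p.Prime := by rcases hp with rfl | rfl <;> norm_num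
  have : Fact p.Prime := ⟨hpp⟩
  have : CharP F p := by
    apply charP_of_card_eq_prime_pow (f := k * 2)
    rw [hF, pow_mul]
  obtain ⟨σ, hσ⟩ : ∃ σ : F →+* F, ∀ x, σ x = x ^ (p ^ k) :=
    ⟨iterateFrobenius F p k, fun x => iterateFrobenius_def p k x⟩
  have hσσ : ∀ x, σ (σ x) = x := by
    intro x
    rw [hσ, hσ, ← pow_mul, ← pow_two, ← hF, FiniteField.pow_card]
  have hodd : p ^ k % 2 = 1 := by
    rcases hp with rfl | rfl <;> simp [Nat.pow_mod]
  have hcard : Fintype.card F % 8 = 1 := by rw [hF]; exact sq_mod _ hodd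
  have hone : ∀ a, σ a = a → a ^ (2 * l + p) = 1 → a = 1 := fun a ha h =>
    hone_aux (p ^ k) (2 * l + p) (pow_pos hpp.pos k) (by have := hpp.pos; omega) hl a
      (by rw [← hσ, ha]) h
  have hfun : (fun x : F =>
          x ^ ((p ^ k + 1) * l + (p - 1) * p ^ k + 1)
            + x ^ ((p ^ k + 1) * l + p * p ^ k)
            - x ^ ((p ^ k + 1) * l + p ^ k + (p - 1))) =
      fun x => (x * σ x) ^ l * ((σ x) ^ (p - 1) * x + (σ x) ^ p - σ x * x ^ (p - 1)) := by
    funext x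
    rw [hσ]
    generalize p ^ k = q
    generalize p - 1 = u
    ring
  rw [hfun, ← Finite.injective_iff_bijective]
  rcases hp with rfl | rfl
  · have h3 : (3 : F) = 0 := by exact_mod_cast CharP.cast_eq_zero F 3
    have h2 : (2 : F) ≠ 0 := fun h => one_ne_zero (α := F) (by linear_combination h3 - h)
    obtain ⟨i, hi⟩ : IsSquare (-1 : F) := FiniteField.isSquare_neg_one_iff.2 (by omega)
    have hi : i ^ 2 = -1 := by rw [hi]; ring
    have hi8 : i ^ 8 = 1 := by rw [show i ^ 8 = (i ^ 2) ^ 4 by ring, hi]; norm_num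
    constructor
    · intro hinj
      by_contra hk'
      have hσi : σ i = -i := by
        rw [hσ, pow_period i hi8 _ 3 (pow_mod_odd 3 k (Or.inl rfl) hk')]
        linear_combination i * hi
      have := @hinj (1 + i) (1 - i) (by
        simp only [map_add, map_sub, map_one, hσi]
        have : ∀ a b c d : F, a = c → b = d → a ^ l * b = c ^ l * d := by
          rintro a b c d rfl rfl; rfl
        apply this
        · ring
        · norm_num
          grind)
      have hi0 : i = 0 := by
        apply mul_left_cancel₀ h2
        linear_combination this
      simp [hi0] at hi
    · intro hk'
      have hσi : σ i = i := by
        rw [hσ, pow_period i hi8 _ 1 (pow_mod_even 3 k (Or.inl rfl) hk'), pow_one]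
      apply core_inj σ hσσ h2 3 l (by norm_num) _ (fun s d => d ^ 3 + d * s ^ 2) _ _ _ _
        (inj3 σ i hi hσi) hone
      · intro x
        simp only [map_add, map_sub, map_mul, map_pow, hσσ]
        norm_num
        grind
      · intro x
        simp only [map_add, map_sub, map_mul, map_pow, hσσ]
        norm_num
        grind
      · intro a x ha
        simp only [map_mul, ha]
        norm_num
        ring
      · intro a s d
        ring
  · have h5 : (5 : F) = 0 := by exact_mod_cast CharP.cast_eq_zero F 5
    have h2 : (2 : F) ≠ 0 := fun h => one_ne_zero (α := F) (by linear_combination h5 - 2 * h)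
    obtain ⟨r, hr⟩ : IsSquare (-2 : F) := FiniteField.isSquare_neg_two_iff.2 (by omega)
    have hr : r ^ 2 = 3 := by linear_combination -h5 - hr
    have hr4 : r ^ 4 = -1 := by linear_combination (r ^ 2 + 3) * hr + 2 * h5
    have hr8 : r ^ 8 = 1 := by rw [show r ^ 8 = (r ^ 4) ^ 2 by ring, hr4]; norm_num
    constructor
    · intro hinj
      by_contra hk'
      have hσr : σ r = -r := by
        rw [hσ, pow_period r hr8 _ 5 (pow_mod_odd 5 k (Or.inr rfl) hk')]
        linear_combination r * hr4
      have := @hinj (1 + r) (1 - r) (by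
        simp only [map_add, map_sub, map_one, hσr]
        have : ∀ a b c d : F, a = c → b = d → a ^ l * b = c ^ l * d := by
          rintro a b c d rfl rfl; rfl
        apply this
        · ring
        · norm_num
          grind)
      have hr0 : r = 0 := by
        apply mul_left_cancel₀ h2
        linear_combination this
      rw [hr0] at hr4
      norm_num at hr4
    · intro hk'
      have hσr : σ r = r := by
        rw [hσ, pow_period r hr8 _ 1 (pow_mod_even 5 k (Or.inr rfl) hk'), pow_one]
      apply core_inj σ hσσ h2 5 l (by norm_num) _ (fun s d => d * (d ^ 2 + 2 * s ^ 2) ^ 2) _ _ _ _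
        (inj5 σ r hr hσr) hone
      · intro x
        simp only [map_add, map_sub, map_mul, map_pow, hσσ]
        norm_num
        grind
      · intro x
        simp only [map_add, map_sub, map_mul, map_pow, hσσ]
        norm_num
        grind
      · intro a x ha
        simp only [map_mul, ha]
        norm_num
        ring
      · intro a s d
        ring
end
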